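/- There exist universal constants c > 0 and C > 0 such that the following holds. Let n be a positive integer, d ≥ 2 an integer, f : ℝ^n → {−1, 1} measurable, and p : ℝ^n → ℝ a polynomial of degree at most d. Then: (i) E_{x∼γ_n}[|f(x) − p(x)|] ≥ (c/log d) · GNS_{(log d/d)²}(f); and (ii) for every ε ∈ (0, 1), E_{x∼γ_n}[|f(x) − p(x)|] ≥ GNS_ε(f)/4 − C d √ε. -/

import Mathlib

open MeasureTheory ProbabilityTheory

/-- The standard `n`-dimensional Gaussian distribution `N(0, I_n)` on `ℝ^n`. -/
noncomputable def gaussian (n : ℕ) : Measure (Fin n → ℝ) :=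
  Measure.pi fun _ => gaussianReal 0 1

/-- Gaussian noise sensitivity: `GNS_ρ(f) = Pr[f(x) ≠ f(y)]` where `x, z ∼ γ_n` are
independent and `y = (1−ρ)x + √(1−(1−ρ)²) z`. -/
noncomputable def gns (n : ℕ) (ρ : ℝ) (f : (Fin n → ℝ) → ℝ) : ℝ :=
  (((gaussian n).prod (gaussian n))
    {p : (Fin n → ℝ) × (Fin n → ℝ) |
      f p.1 ≠ f (fun i => (1 - ρ) * p.1 i + Real.sqrt (1 - (1 - ρ) ^ 2) * p.2 i)}).toReal

instance isProbabilityMeasure_gaussian (n : ℕ) : IsProbabilityMeasure (gaussian n) := by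
  unfold gaussian; infer_instance

lemma gaussian_eq_map_stdGaussian (n : ℕ) :
    gaussian n = (stdGaussian (EuclideanSpace ℝ (Fin n))).map
      (EuclideanSpace.equiv (Fin n) ℝ) := by
  rw [← map_pi_eq_stdGaussian, Measure.map_map (by fun_prop) (by fun_prop)]
  exact Measure.map_id.symm

instance isGaussian_gaussian (n : ℕ) : IsGaussian (gaussian n) := by
  rw [gaussian_eq_map_stdGaussian]; infer_instance

lemma integral_dual_gaussian (n : ℕ) (L : StrongDual ℝ (Fin n → ℝ)) :
    ∫ x, L x ∂(gaussian n) = 0 := by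
  rw [gaussian_eq_map_stdGaussian, integral_map (by fun_prop) (by fun_prop)]
  exact integral_strongDual_stdGaussian
    (L.comp (EuclideanSpace.equiv (Fin n) ℝ : EuclideanSpace ℝ (Fin n) →L[ℝ] (Fin n → ℝ)))

lemma measurePreserving_rotation (n : ℕ) (θ : ℝ) :
    MeasurePreserving
      (ContinuousLinearMap.rotation θ : (Fin n → ℝ) × (Fin n → ℝ) →L[ℝ] _)
      ((gaussian n).prod (gaussian n)) ((gaussian n).prod (gaussian n)) :=
  ⟨by fun_prop,
    IsGaussian.map_rotation_eq_self_of_forall_strongDual_eq_zero (integral_dual_gaussian n) θ⟩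

/-- The point at angle `s` on the ellipse through `w.1` and `w.2`. -/
noncomputable def ellipsePoint {n : ℕ} (w : (Fin n → ℝ) × (Fin n → ℝ)) (s : ℝ) : Fin n → ℝ :=
  Real.cos s • w.1 + Real.sin s • w.2

@[simp] lemma ellipsePoint_zero {n : ℕ} (w : (Fin n → ℝ) × (Fin n → ℝ)) :
    ellipsePoint w 0 = w.1 := by
  simp [ellipsePoint]

lemma ellipsePoint_rotation {n : ℕ} (w : (Fin n → ℝ) × (Fin n → ℝ)) (r s : ℝ) :
    ellipsePoint (ContinuousLinearMap.rotation r w) s = ellipsePoint w (r + s) := by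
  ext i
  simp only [ellipsePoint, ContinuousLinearMap.rotation_apply, Real.cos_add, Real.sin_add,
    Pi.add_apply, Pi.smul_apply, smul_eq_mul]
  ring

lemma continuous_ellipsePoint (n : ℕ) :
    Continuous fun q : ((Fin n → ℝ) × (Fin n → ℝ)) × ℝ => ellipsePoint q.1 q.2 := by
  unfold ellipsePoint; fun_prop

lemma measurePreserving_ellipsePoint (n : ℕ) (s : ℝ) :
    MeasurePreserving (fun w => ellipsePoint w s) ((gaussian n).prod (gaussian n))
      (gaussian n) :=
  measurePreserving_fst.comp (measurePreserving_rotation n s)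

lemma gns_eq (n : ℕ) {ρ : ℝ} (h0 : 0 ≤ ρ) (h2 : ρ ≤ 2) (f : (Fin n → ℝ) → ℝ) :
    gns n ρ f = ((gaussian n).prod (gaussian n)).real
      {w | f (ellipsePoint w 0) ≠ f (ellipsePoint w (Real.arccos (1 - ρ)))} := by
  rw [gns, Measure.real]
  congr 3
  ext w
  rw [ellipsePoint_zero]
  have : ellipsePoint w (Real.arccos (1 - ρ)) =
      fun i => (1 - ρ) * w.1 i + √(1 - (1 - ρ) ^ 2) * w.2 i := by
    ext i
    simp [ellipsePoint, Real.cos_arccos (by linarith : -1 ≤ 1 - ρ) (by linarith),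
      Real.sin_arccos]
  rw [this]

lemma integrable_eval_gaussian {n : ℕ} (p : MvPolynomial (Fin n) ℝ) :
    Integrable (fun x => MvPolynomial.eval x p) (gaussian n) := by
  simp only [MvPolynomial.eval_eq']
  refine integrable_finsetSum _ fun m _ => Integrable.const_mul ?_ _
  refine Integrable.fintype_prod (f := fun i (t : ℝ) => t ^ m i) fun i => ?_
  exact ((memLp_id_gaussianReal' (m i : ENNReal) (by simp)).integrable_norm_pow'
    (f := id)).mono' (by fun_prop) (by simp)

lemma measurable_mvPolynomial_eval {n : ℕ} (p : MvPolynomial (Fin n) ℝ) :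
    Measurable fun x => MvPolynomial.eval x p :=
  (MvPolynomial.continuous_eval p).measurable

lemma lintegral_ofReal_abs_sub {n : ℕ} {f : (Fin n → ℝ) → ℝ} (hf : Measurable f)
    (hf1 : ∀ x, f x = 1 ∨ f x = -1) (p : MvPolynomial (Fin n) ℝ) :
    ∫⁻ x, ENNReal.ofReal |f x - MvPolynomial.eval x p| ∂(gaussian n) =
      ENNReal.ofReal (∫ x, |f x - MvPolynomial.eval x p| ∂(gaussian n)) := by
  rw [ofReal_integral_eq_lintegral_ofReal _ (Filter.Eventually.of_forall fun _ => abs_nonneg _)]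
  refine (Integrable.sub ?_ (integrable_eval_gaussian p)).abs
  refine Integrable.of_bound hf.aestronglyMeasurable 1 (Filter.Eventually.of_forall fun x => ?_)
  rcases hf1 x with h | h <;> simp [h]

/-- Markov's inequality for the `L¹` error accumulated along a window of a random ellipse. -/
lemma measureReal_window_le {n : ℕ} {g : (Fin n → ℝ) → ENNReal} (hg : Measurable g)
    {E : ℝ} (hE : 0 ≤ E) (hgE : ∫⁻ x, g x ∂(gaussian n) = ENNReal.ofReal E)
    {W t : ℝ} (hW : 0 ≤ W) (ht : 0 < t) :
    ((gaussian n).prod (gaussian n)).real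
      {w | ENNReal.ofReal t ≤ ∫⁻ s in Set.Icc (-W) W, g (ellipsePoint w s)} ≤ 2 * W * E / t := by
  have hm : Measurable fun q : ((Fin n → ℝ) × (Fin n → ℝ)) × ℝ => g (ellipsePoint q.1 q.2) :=
    hg.comp (continuous_ellipsePoint n).measurable
  have key : ∫⁻ w, (∫⁻ s in Set.Icc (-W) W, g (ellipsePoint w s))
      ∂((gaussian n).prod (gaussian n)) = ENNReal.ofReal (2 * W * E) := by
    rw [lintegral_lintegral_swap hm.aemeasurable]
    simp_rw [(measurePreserving_ellipsePoint n _).lintegral_comp hg, hgE]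
    simp only [lintegral_const, MeasurableSet.univ, Measure.restrict_apply, Set.univ_inter,
      Real.volume_Icc]
    rw [← ENNReal.ofReal_mul hE]
    congr 1; ring
  have h := meas_ge_le_lintegral_div (μ := (gaussian n).prod (gaussian n))
    (hm.lintegral_prod_right' (ν := volume.restrict (Set.Icc (-W) W))).aemeasurable
    (ε := ENNReal.ofReal t) (by simpa using ht) (by simp)
  rw [key, ← ENNReal.ofReal_div_of_pos ht] at h
  exact ENNReal.toReal_le_of_le_ofReal (by positivity) h

/-- The sign of a real number, with the sign of `0` being `1`. -/
noncomputable def boolSign (t : ℝ) : ℝ := if 0 ≤ t then 1 else -1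

lemma measurable_boolSign : Measurable boolSign :=
  Measurable.ite measurableSet_Ici measurable_const measurable_const

lemma one_le_abs_sub_of_ne_boolSign {a t : ℝ} (ha : a = 1 ∨ a = -1) (h : a ≠ boolSign t) :
    1 ≤ |a - t| := by
  unfold boolSign at h
  rcases ha with rfl | rfl <;> split_ifs at h with ht <;> simp at h
  · rw [abs_of_nonneg] <;> linarith
  · rw [abs_of_nonpos] <;> linarith

lemma measureReal_ne_boolSign_le {n : ℕ} {f : (Fin n → ℝ) → ℝ} (hf : Measurable f)
    (hf1 : ∀ x, f x = 1 ∨ f x = -1) (p : MvPolynomial (Fin n) ℝ) (s : ℝ) :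
    ((gaussian n).prod (gaussian n)).real
      {w | f (ellipsePoint w s) ≠ boolSign (MvPolynomial.eval (ellipsePoint w s) p)} ≤
      ∫ x, |f x - MvPolynomial.eval x p| ∂(gaussian n) := by
  have hg : Measurable fun x => ENNReal.ofReal |f x - MvPolynomial.eval x p| :=
    (hf.sub (measurable_mvPolynomial_eval p)).abs.ennreal_ofReal
  have h := meas_ge_le_lintegral_div (μ := (gaussian n).prod (gaussian n))
    (hg.comp (measurePreserving_ellipsePoint n s).measurable).aemeasurable
    (ε := 1) (by simp) (by simp)
  simp only [Function.comp_def] at h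
  rw [(measurePreserving_ellipsePoint n s).lintegral_comp hg, div_one,
    lintegral_ofReal_abs_sub hf hf1] at h
  refine ENNReal.toReal_le_of_le_ofReal (integral_nonneg fun _ => abs_nonneg _)
    ((measure_mono fun w hw => ?_).trans h)
  simpa using one_le_abs_sub_of_ne_boolSign (hf1 _) hw

open Polynomial in
/-- `f` is a trigonometric polynomial of degree at most `D`. -/
def IsTrigPoly (D : ℕ) (f : ℝ → ℂ) : Prop :=
  ∃ q : ℂ[X], q.natDegree ≤ 2 * D ∧
    ∀ s : ℝ, f s * Complex.exp (s * Complex.I) ^ D = q.eval (Complex.exp (s * Complex.I))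

namespace IsTrigPoly

open Polynomial

variable {D D' : ℕ} {f g : ℝ → ℂ}

lemma mono (hf : IsTrigPoly D f) (h : D ≤ D') : IsTrigPoly D' f := by
  obtain ⟨q, hq, hfq⟩ := hf
  refine ⟨q * X ^ (D' - D), natDegree_mul_le.trans ?_, fun s => ?_⟩
  · rw [natDegree_X_pow]; omega
  · rw [eval_mul, ← hfq, eval_pow, eval_X, mul_assoc, ← pow_add, Nat.add_sub_cancel' h]

lemma const (c : ℂ) : IsTrigPoly 0 fun _ => c :=
  ⟨C c, by simp, by simp⟩

lemma add (hf : IsTrigPoly D f) (hg : IsTrigPoly D g) : IsTrigPoly D fun s => f s + g s := by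
  obtain ⟨p, hp, hfp⟩ := hf
  obtain ⟨q, hq, hgq⟩ := hg
  exact ⟨p + q, (natDegree_add_le _ _).trans (max_le hp hq), fun s => by
    rw [add_mul, hfp, hgq, eval_add]⟩

lemma mul (hf : IsTrigPoly D f) (hg : IsTrigPoly D' g) :
    IsTrigPoly (D + D') fun s => f s * g s := by
  obtain ⟨p, hp, hfp⟩ := hf
  obtain ⟨q, hq, hgq⟩ := hg
  exact ⟨p * q, natDegree_mul_le.trans (by omega), fun s => by
    rw [eval_mul, ← hfp, ← hgq]; ring⟩

lemma pow (hf : IsTrigPoly D f) (m : ℕ) : IsTrigPoly (D * m) fun s => f s ^ m := by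
  induction m with
  | zero => simpa using const 1
  | succ m ih => simpa only [pow_succ, mul_add, mul_one] using ih.mul hf

lemma sum {ι : Type*} (t : Finset ι) {f : ι → ℝ → ℂ} (hf : ∀ i ∈ t, IsTrigPoly D (f i)) :
    IsTrigPoly D fun s => ∑ i ∈ t, f i s := by
  classical
  induction t using Finset.induction_on with
  | empty => simpa using (const 0).mono (Nat.zero_le D)
  | insert i t hi ih =>
    simp only [Finset.sum_insert hi]
    exact (hf i (by simp)).add (ih fun j hj => hf j (by simp [hj]))

lemma prod {ι : Type*} (t : Finset ι) {f : ι → ℝ → ℂ} {m : ι → ℕ}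
    (hf : ∀ i ∈ t, IsTrigPoly (m i) (f i)) :
    IsTrigPoly (∑ i ∈ t, m i) fun s => ∏ i ∈ t, f i s := by
  classical
  induction t using Finset.induction_on with
  | empty => simpa using const 1
  | insert i t hi ih =>
    simp only [Finset.sum_insert hi, Finset.prod_insert hi]
    exact (hf i (by simp)).mul (ih fun j hj => hf j (by simp [hj]))

lemma cos_add_sin (a b : ℂ) :
    IsTrigPoly 1 fun s => Complex.cos s * a + Complex.sin s * b := by
  refine ⟨C (a / 2) * (X ^ 2 + 1) - C (b * Complex.I / 2) * (X ^ 2 - 1), ?_, fun s => ?_⟩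
  · compute_degree
  · have h : Complex.exp (-(s : ℂ) * Complex.I) * Complex.exp (s * Complex.I) = 1 := by
      rw [← Complex.exp_add]; simp
    simp only [Complex.cos, Complex.sin, eval_sub, eval_mul, eval_C, eval_add, eval_pow, eval_X,
      eval_one]
    linear_combination (a / 2 + b * Complex.I / 2) * h

lemma mvPolynomial_eval_ellipsePoint {n d : ℕ} {p : MvPolynomial (Fin n) ℝ}
    (hp : p.totalDegree ≤ d) (w : (Fin n → ℝ) × (Fin n → ℝ)) :
    IsTrigPoly d fun s => ((MvPolynomial.eval (ellipsePoint w s) p : ℝ) : ℂ) := by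
  simp only [MvPolynomial.eval_eq', Complex.ofReal_sum, Complex.ofReal_mul, Complex.ofReal_prod,
    Complex.ofReal_pow]
  refine sum _ fun m hm => ?_
  have hm' : 0 + ∑ i, 1 * m i ≤ d := by
    have := (MvPolynomial.le_totalDegree hm).trans hp
    rw [Finsupp.sum_fintype _ _ (by simp)] at this
    simpa using this
  refine IsTrigPoly.mono ((const _).mul (prod _ fun i _ => IsTrigPoly.pow ?_ (m i))) hm'
  simpa [ellipsePoint] using cos_add_sin (w.1 i : ℂ) (w.2 i)

end IsTrigPoly

lemma integral_exp_int_mul_I (n : ℤ) :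
    ∫ s in (-Real.pi)..Real.pi, Complex.exp (n * Complex.I * s) =
      if n = 0 then (2 * Real.pi : ℂ) else 0 := by
  split_ifs with h
  · simp [h]; ring
  · have hc : (n : ℂ) * Complex.I ≠ 0 := by simp [h]
    rw [integral_exp_mul_complex hc]
    have : Complex.exp (n * Complex.I * Real.pi) =
        Complex.exp (n * Complex.I * ((-Real.pi : ℝ) : ℂ)) := by
      rw [Complex.exp_eq_exp_iff_exists_int]
      exact ⟨n, by push_cast; ring⟩
    rw [this, sub_self, zero_div]

open Polynomial in
lemma integral_eval_exp_mul_inv_pow (q : ℂ[X]) (k : ℕ) :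
    ∫ s in (-Real.pi)..Real.pi, q.eval (Complex.exp (s * Complex.I)) *
      (Complex.exp (s * Complex.I))⁻¹ ^ k = 2 * Real.pi * q.coeff k := by
  have h1 : ∀ s : ℝ, q.eval (Complex.exp (s * Complex.I)) * (Complex.exp (s * Complex.I))⁻¹ ^ k =
      ∑ j ∈ q.support, q.coeff j * Complex.exp (((j - k : ℤ) : ℂ) * Complex.I * s) := by
    intro s
    rw [eval_eq_sum, Polynomial.sum, Finset.sum_mul]
    refine Finset.sum_congr rfl fun j _ => ?_
    rw [mul_assoc, ← Complex.exp_neg, ← Complex.exp_nat_mul, ← Complex.exp_nat_mul,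
      ← Complex.exp_add]
    congr 2
    push_cast; ring
  simp_rw [h1]
  rw [intervalIntegral.integral_finsetSum
    (fun j _ => (by fun_prop : Continuous _).intervalIntegrable _ _)]
  simp_rw [intervalIntegral.integral_const_mul, integral_exp_int_mul_I]
  rw [Finset.sum_eq_single k]
  · simp; ring
  · intro j _ hj
    rw [if_neg (by omega), mul_zero]
  · intro hk
    simp [notMem_support_iff.mp hk]

lemma IsTrigPoly.norm_sub_zero_le {D : ℕ} {f : ℝ → ℂ} (hf : IsTrigPoly D f) {M : ℝ}
    (hM : ∫ s in (-Real.pi)..Real.pi, ‖f s‖ ≤ M) (t : ℝ) :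
    ‖f t - f 0‖ ≤ (2 * D + 1) * D * M / (2 * Real.pi) * |t| := by
  obtain ⟨q, hq, hfq⟩ := hf
  have hcoeff : ∀ k, ‖q.coeff k‖ ≤ M / (2 * Real.pi) := by
    intro k
    rw [le_div_iff₀ (by positivity)]
    have h : ‖(2 * Real.pi : ℂ) * q.coeff k‖ ≤ M := by
      rw [← integral_eval_exp_mul_inv_pow]
      refine (intervalIntegral.norm_integral_le_integral_norm (by linarith [Real.pi_pos])).trans
        (le_of_eq_of_le ?_ hM)
      simp only [← hfq, norm_mul, norm_inv, norm_pow, Complex.norm_exp_ofReal_mul_I, inv_one,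
        one_pow, mul_one]
    rw [norm_mul] at h
    have h2 : ‖(2 * Real.pi : ℂ)‖ = 2 * Real.pi := by
      simp [abs_of_pos Real.pi_pos]
    rw [h2] at h; linarith
  have hM0 : 0 ≤ M / (2 * Real.pi) := (norm_nonneg _).trans (hcoeff 0)
  have hexp : ∀ s : ℝ, f s = ∑ k ∈ Finset.range (2 * D + 1),
      q.coeff k * Complex.exp (Complex.I * (((k - D : ℝ) * s : ℝ) : ℂ)) := by
    intro s
    have h := hfq s
    have h0 : Complex.exp (s * Complex.I) ^ D ≠ 0 := pow_ne_zero _ (Complex.exp_ne_zero _)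
    rw [← mul_left_inj' h0, h, Polynomial.eval_eq_sum_range' (Nat.lt_succ_of_le hq),
      Finset.sum_mul]
    refine Finset.sum_congr rfl fun k _ => ?_
    rw [mul_assoc, ← Complex.exp_nat_mul, ← Complex.exp_nat_mul, ← Complex.exp_add]
    congr 2
    push_cast; ring
  rw [hexp t, hexp 0, ← Finset.sum_sub_distrib]
  calc _ ≤ ∑ k ∈ Finset.range (2 * D + 1), M / (2 * Real.pi) * (D * |t|) := by
        refine norm_sum_le_of_le _ fun k hk => ?_
        rw [← mul_sub, norm_mul]
        refine mul_le_mul (hcoeff k) ?_ (norm_nonneg _) hM0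
        rw [mul_zero, Complex.ofReal_zero, mul_zero, Complex.exp_zero]
        refine (Real.norm_exp_I_mul_ofReal_sub_one_le).trans ?_
        rw [norm_mul, Real.norm_eq_abs, Real.norm_eq_abs]
        refine mul_le_mul_of_nonneg_right ?_ (abs_nonneg t)
        have : (k : ℝ) ≤ 2 * D := by exact_mod_cast Nat.lt_succ_iff.mp (Finset.mem_range.mp hk)
        rw [abs_le]; constructor <;> linarith [(Nat.cast_nonneg k : (0 : ℝ) ≤ k)]
    _ = _ := by
        rw [Finset.sum_const, Finset.card_range]; simp; ring

/-- The Fejér kernel of degree `b`, normalized to be `1` at `0`. -/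
noncomputable def fejer (b : ℕ) (s : ℝ) : ℝ :=
  ‖∑ j ∈ Finset.range (b + 1), Complex.exp (s * Complex.I) ^ j‖ ^ 2 / (b + 1) ^ 2

lemma fejer_nonneg (b : ℕ) (s : ℝ) : 0 ≤ fejer b s := by
  unfold fejer; positivity

@[simp] lemma fejer_zero (b : ℕ) : fejer b 0 = 1 := by
  have h : ‖((b : ℂ) + 1)‖ = b + 1 := by exact_mod_cast Complex.norm_natCast (b + 1)
  simp only [fejer, Complex.ofReal_zero, zero_mul, Complex.exp_zero, one_pow, Finset.sum_const,
    Finset.card_range, nsmul_eq_mul, mul_one, Nat.cast_add, Nat.cast_one, h]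
  exact div_self (by positivity)

lemma fejer_le_one (b : ℕ) (s : ℝ) : fejer b s ≤ 1 := by
  unfold fejer
  refine div_le_one_of_le₀ (pow_le_pow_left₀ (norm_nonneg _) ?_ 2) (by positivity)
  refine (norm_sum_le _ _).trans ?_
  simp [Complex.norm_exp_ofReal_mul_I]

lemma continuous_fejer (b : ℕ) : Continuous (fejer b) := by
  unfold fejer; fun_prop

lemma fejer_mul_exp_pow (b : ℕ) (s : ℝ) :
    (fejer b s : ℂ) * Complex.exp (s * Complex.I) ^ b =
      (∑ j ∈ Finset.range (b + 1), Complex.exp (s * Complex.I) ^ j) ^ 2 / (b + 1) ^ 2 := by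
  set e := Complex.exp (s * Complex.I) with he
  have hc : (starRingEnd ℂ) e * e = 1 := by
    rw [Complex.conj_mul', he, Complex.norm_exp_ofReal_mul_I]; simp
  have h : (starRingEnd ℂ) (∑ j ∈ Finset.range (b + 1), e ^ j) * e ^ b =
      ∑ j ∈ Finset.range (b + 1), e ^ j := by
    rw [map_sum, Finset.sum_mul, ← Finset.sum_range_reflect]
    refine Finset.sum_congr rfl fun j hj => ?_
    have hj' : j ≤ b := Nat.lt_succ_iff.mp (Finset.mem_range.mp hj)
    have hb : e ^ b = e ^ (b - j) * e ^ j := by rw [← pow_add]; congr 1; omega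
    have : b + 1 - 1 - j = b - j := by omega
    rw [this, map_pow, hb, ← mul_assoc, ← mul_pow, hc, one_pow, one_mul]
  have h2 : (fejer b s : ℂ) = (∑ j ∈ Finset.range (b + 1), e ^ j) *
      (starRingEnd ℂ) (∑ j ∈ Finset.range (b + 1), e ^ j) / (b + 1) ^ 2 := by
    rw [Complex.mul_conj', fejer]; push_cast; rfl
  rw [h2, div_mul_eq_mul_div, mul_assoc, h, ← sq]

open Polynomial in
lemma eval_geom_sq (b : ℕ) (z : ℂ) :
    (C (((b : ℂ) + 1) ^ 2)⁻¹ * (∑ j ∈ Finset.range (b + 1), (X : ℂ[X]) ^ j) ^ 2).eval z =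
      (∑ j ∈ Finset.range (b + 1), z ^ j) ^ 2 / (b + 1) ^ 2 := by
  simp [eval_finsetSum, div_eq_inv_mul]

open Polynomial in
lemma isTrigPoly_fejer (b : ℕ) : IsTrigPoly b fun s => (fejer b s : ℂ) := by
  refine ⟨C (((b : ℂ) + 1) ^ 2)⁻¹ * (∑ j ∈ Finset.range (b + 1), (X : ℂ[X]) ^ j) ^ 2, ?_,
    fun s => ?_⟩
  · refine (natDegree_C_mul_le _ _).trans (natDegree_pow_le_of_le 2 ?_)
    refine natDegree_sum_le_of_forall_le _ _ fun j hj => ?_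
    rw [natDegree_X_pow]
    exact Nat.lt_succ_iff.mp (Finset.mem_range.mp hj)
  · rw [eval_geom_sq, fejer_mul_exp_pow]

open Polynomial in
lemma integral_fejer (b : ℕ) :
    ∫ s in (-Real.pi)..Real.pi, fejer b s = 2 * Real.pi / (b + 1) := by
  have h := integral_eval_exp_mul_inv_pow
    (C (((b : ℂ) + 1) ^ 2)⁻¹ * (∑ j ∈ Finset.range (b + 1), (X : ℂ[X]) ^ j) ^ 2) b
  have hc : ((∑ j ∈ Finset.range (b + 1), (X : ℂ[X]) ^ j) ^ 2).coeff b = b + 1 := by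
    rw [sq, coeff_mul, Finset.sum_congr rfl (g := fun _ => (1 : ℂ))]
    · simp
    · intro x hx
      have := Finset.HasAntidiagonal.mem_antidiagonal.mp hx
      simp only [finsetSum_coeff, coeff_X_pow, Finset.sum_ite_eq, Finset.mem_range]
      rw [if_pos (by omega), if_pos (by omega), one_mul]
  rw [coeff_C_mul, hc] at h
  have h1 : ∀ s : ℝ, (C (((b : ℂ) + 1) ^ 2)⁻¹ *
      (∑ j ∈ Finset.range (b + 1), (X : ℂ[X]) ^ j) ^ 2).eval (Complex.exp (s * Complex.I)) *
      (Complex.exp (s * Complex.I))⁻¹ ^ b = (fejer b s : ℂ) := by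
    intro s
    rw [eval_geom_sq, ← fejer_mul_exp_pow, mul_assoc, ← mul_pow,
      mul_inv_cancel₀ (Complex.exp_ne_zero _), one_pow, mul_one]
  simp_rw [h1, intervalIntegral.integral_ofReal] at h
  have hb : ((b : ℂ) + 1) ≠ 0 := by exact_mod_cast Nat.succ_ne_zero b
  apply Complex.ofReal_injective
  rw [h]; push_cast; field_simp

lemma fejer_le (b : ℕ) {s : ℝ} (hs : |s| ≤ Real.pi) (hs0 : s ≠ 0) :
    fejer b s ≤ Real.pi ^ 2 / ((b + 1) ^ 2 * s ^ 2) := by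
  have h1 : 2 / Real.pi * |s| ≤ ‖Complex.exp (s * Complex.I) - 1‖ := by
    rw [mul_comm (s : ℂ), Complex.norm_exp_I_mul_ofReal_sub_one, norm_mul, Real.norm_eq_abs,
      Real.norm_eq_abs, abs_two]
    have := Real.mul_abs_le_abs_sin (x := s / 2) (by
      rw [abs_div, abs_two]; linarith)
    rw [abs_div, abs_two] at this
    linarith
  have h2 : ‖∑ j ∈ Finset.range (b + 1), Complex.exp (s * Complex.I) ^ j‖ *
      ‖Complex.exp (s * Complex.I) - 1‖ ≤ 2 := by
    rw [← norm_mul, geom_sum_mul]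
    refine (norm_sub_le _ _).trans ?_
    rw [norm_pow, Complex.norm_exp_ofReal_mul_I]; norm_num
  have hs' : 0 < |s| := abs_pos.mpr hs0
  have h3 : ‖∑ j ∈ Finset.range (b + 1), Complex.exp (s * Complex.I) ^ j‖ ≤ Real.pi / |s| := by
    rw [le_div_iff₀ hs']
    have := (mul_le_mul_of_nonneg_left h1 (norm_nonneg _)).trans h2
    rw [mul_comm (2 / Real.pi), ← mul_assoc, mul_div_assoc', div_le_iff₀ Real.pi_pos] at this
    linarith
  rw [fejer, div_le_div_iff₀ (by positivity) (by positivity)]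
  have h4 := pow_le_pow_left₀ (norm_nonneg _) h3 2
  rw [div_pow, sq_abs, le_div_iff₀ (by positivity)] at h4
  nlinarith [sq_nonneg ((b : ℝ) + 1)]

/-- A localizing kernel: a Fejér kernel times a high power of a wider Fejér kernel. -/
noncomputable def jackson (d m : ℕ) (s : ℝ) : ℝ := fejer d s * fejer (d / m) s ^ m

lemma jackson_nonneg (d m : ℕ) (s : ℝ) : 0 ≤ jackson d m s :=
  mul_nonneg (fejer_nonneg _ _) (pow_nonneg (fejer_nonneg _ _) _)

@[simp] lemma jackson_zero (d m : ℕ) : jackson d m 0 = 1 := by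
  simp [jackson]

lemma jackson_le_fejer (d m : ℕ) (s : ℝ) : jackson d m s ≤ fejer d s :=
  mul_le_of_le_one_right (fejer_nonneg _ _) (pow_le_one₀ (fejer_nonneg _ _) (fejer_le_one _ _))

lemma jackson_le_one (d m : ℕ) (s : ℝ) : jackson d m s ≤ 1 :=
  (jackson_le_fejer d m s).trans (fejer_le_one d s)

lemma continuous_jackson (d m : ℕ) : Continuous (jackson d m) :=
  (continuous_fejer d).mul ((continuous_fejer _).pow m)

lemma isTrigPoly_jackson (d m : ℕ) : IsTrigPoly (2 * d) fun s => (jackson d m s : ℂ) := by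
  have h := (isTrigPoly_fejer d).mul ((isTrigPoly_fejer (d / m)).pow m)
  simp only [jackson, Complex.ofReal_mul, Complex.ofReal_pow]
  exact h.mono (by have := Nat.div_mul_le_self d m; omega)

lemma integral_jackson_le {d : ℕ} (hd : 0 < d) (m : ℕ) :
    ∫ s in (-Real.pi)..Real.pi, jackson d m s ≤ 2 * Real.pi / d := by
  refine (intervalIntegral.integral_mono_on (by linarith [Real.pi_pos])
    ((continuous_jackson d m).intervalIntegrable _ _)
    ((continuous_fejer d).intervalIntegrable _ _) fun s _ => jackson_le_fejer d m s).trans ?_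
  rw [integral_fejer]
  gcongr; linarith

lemma jackson_le_exp {d m : ℕ} (hd : 0 < d) (hm : 0 < m) {s : ℝ} (hs : |s| ≤ Real.pi)
    (hms : Real.pi * 2 * m ≤ d * |s|) : jackson d m s ≤ Real.exp (-m) := by
  have hd' : (0 : ℝ) < d := Nat.cast_pos.mpr hd
  have hm' : (0 : ℝ) < m := Nat.cast_pos.mpr hm
  have hs0 : 0 < |s| := by
    by_contra h
    have : |s| = 0 := le_antisymm (not_lt.mp h) (abs_nonneg s)
    rw [this, mul_zero] at hms
    have : 0 < Real.pi * 2 * m := by positivity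
    linarith
  have hq : (d : ℝ) ≤ m * ((d / m : ℕ) + 1) := by
    exact_mod_cast (Nat.lt_mul_div_succ d hm).le
  have h1 : fejer (d / m) s ≤ Real.exp (-1) := by
    refine (fejer_le _ hs (abs_pos.mp hs0)).trans ?_
    have h2 : Real.pi * 2 ≤ ((d / m : ℕ) + 1) * |s| := by
      have := hms.trans (mul_le_mul_of_nonneg_right hq hs0.le)
      rw [mul_assoc (m : ℝ), mul_comm _ (m : ℝ)] at this
      exact le_of_mul_le_mul_left this hm'
    have h3 := pow_le_pow_left₀ (by positivity) h2 2
    rw [mul_pow, mul_pow, sq_abs] at h3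
    have h4 : (1 : ℝ) / 4 ≤ Real.exp (-1) := by
      rw [Real.exp_neg, one_div]
      exact inv_anti₀ (Real.exp_pos 1) (by linarith [Real.exp_one_lt_d9])
    refine le_trans ?_ h4
    rw [div_le_iff₀ (by have := sq_pos_of_pos Real.pi_pos; linarith)]
    linarith
  calc jackson d m s ≤ fejer (d / m) s ^ m :=
        mul_le_of_le_one_left (pow_nonneg (fejer_nonneg _ _) _) (fejer_le_one _ _)
    _ ≤ Real.exp (-1) ^ m := pow_le_pow_left₀ (fejer_nonneg _ _) h1 m
    _ = Real.exp (-m) := by rw [← Real.exp_nat_mul]; congr 1; ring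

lemma intervalIntegrable_abs_sub {F P : ℝ → ℝ} (hF : Measurable F)
    (hF1 : ∀ s, F s = 1 ∨ F s = -1) (hP : Continuous P) (a b : ℝ) :
    IntervalIntegrable (fun s => |F s - P s|) volume a b := by
  have h : IntervalIntegrable F volume a b := by
    refine (intervalIntegrable_const (c := (1 : ℝ))).mono_fun' hF.aestronglyMeasurable
      (Filter.Eventually.of_forall fun s => ?_)
    rcases hF1 s with h | h <;> simp [h]
  exact (h.sub (hP.intervalIntegrable a b)).abs

lemma half_le_abs_sub {a t : ℝ} (ha : a = 1 ∨ a = -1) (ht : |t| ≤ 1 / 2) : 1 / 2 ≤ |a - t| := by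
  rw [abs_le] at ht
  rcases ha with rfl | rfl
  · exact le_abs.mpr (Or.inl (by linarith))
  · exact le_abs.mpr (Or.inr (by linarith))

lemma log_two_le_log_natCast {d : ℕ} (hd : 2 ≤ d) : 0.69 ≤ Real.log d :=
  (by linarith [Real.log_two_gt_d9] : (0.69 : ℝ) ≤ Real.log 2).trans
    (Real.log_le_log (by norm_num) (by exact_mod_cast hd))

lemma jackson_ceil_log_le {d : ℕ} (hd : 2 ≤ d) {s : ℝ} (hs : |s| ≤ Real.pi)
    (hds : 20 * Real.log d / d ≤ |s|) : jackson d ⌈Real.log d⌉₊ s ≤ 1 / d := by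
  have hL := log_two_le_log_natCast hd
  have hd0 : (0 : ℝ) < d := by positivity
  have hm := Nat.ceil_lt_add_one (by linarith : 0 ≤ Real.log d)
  refine (jackson_le_exp (by omega) (Nat.ceil_pos.mpr (by linarith)) hs ?_).trans ?_
  · rw [div_le_iff₀ hd0] at hds
    have h1 := mul_le_mul_of_nonneg_right Real.pi_lt_d2.le (Nat.cast_nonneg (α := ℝ) ⌈Real.log d⌉₊)
    linarith
  · rw [one_div, ← Real.exp_log (inv_pos.mpr hd0), Real.log_inv]
    exact Real.exp_le_exp.mpr (neg_le_neg (Nat.le_ceil _))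

/-- A trigonometric polynomial `P` of degree `d` with a zero cannot be too close in `L¹` to a
`±1`-valued function near that zero. -/
lemma le_integral_abs_sub_of_eq_zero {d : ℕ} (hd : 2 ≤ d) {F P : ℝ → ℝ} (hF : Measurable F)
    (hF1 : ∀ s, F s = 1 ∨ F s = -1) (hPc : Continuous P)
    (hP : IsTrigPoly d fun s => (P s : ℂ)) (hP0 : P 0 = 0)
    (h1 : ∫ s in (-Real.pi)..Real.pi, |F s - P s| ≤ 1)
    (h2 : ∫ s in (-(20 * Real.log d / d))..(20 * Real.log d / d), |F s - P s| ≤ 1 / d) :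
    1 / (200 * d) ≤ ∫ s in (0 : ℝ)..1 / (100 * d), |F s - P s| := by
  have hL := log_two_le_log_natCast hd
  have hd2 : (2 : ℝ) ≤ d := by exact_mod_cast hd
  have hd0 : (0 : ℝ) < d := by linarith
  have hpi := Real.pi_pos
  set η := 20 * Real.log d / d with hη
  have hη0 : 0 ≤ η := by positivity
  set J := jackson d ⌈Real.log d⌉₊ with hJ
  have hJc : Continuous J := continuous_jackson _ _
  have hJint : ∫ s in (-Real.pi)..Real.pi, J s ≤ 2 * Real.pi / d :=
    integral_jackson_le (by omega) _
  have hG : ∀ a b, IntervalIntegrable (fun s => |F s - P s|) volume a b :=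
    intervalIntegrable_abs_sub hF hF1 hPc
  have hind : IntervalIntegrable ((Set.Ioc (-η) η).indicator fun s => |F s - P s|) volume
      (-Real.pi) Real.pi := by
    rw [intervalIntegrable_iff]
    exact (intervalIntegrable_iff.mp (hG _ _)).indicator measurableSet_Ioc
  have hindle : ∫ s in (-Real.pi)..Real.pi,
      (Set.Ioc (-η) η).indicator (fun s => |F s - P s|) s ≤ 1 / d := by
    refine le_trans ?_ h2
    rw [intervalIntegral.integral_of_le (by linarith), intervalIntegral.integral_of_le (by linarith),
      setIntegral_indicator measurableSet_Ioc]
    exact setIntegral_mono_set ((intervalIntegrable_iff_integrableOn_Ioc_of_le (by linarith)).mp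
      (hG _ _)) (Filter.Eventually.of_forall fun _ => abs_nonneg _)
      (Set.inter_subset_right.eventuallyLE)
  have hJ2 : ∫ s in (-Real.pi)..Real.pi, ‖(J s : ℂ)‖ ≤ 2 * Real.pi / d := by
    refine le_of_eq_of_le (intervalIntegral.integral_congr fun s _ => ?_) hJint
    simpa using (jackson_nonneg _ _ _ : 0 ≤ J s)
  have hPJ : ∫ s in (-Real.pi)..Real.pi, ‖(P s : ℂ) * (J s : ℂ)‖ ≤ (2 * Real.pi + 2) / d := by
    have hle : ∀ s ∈ Set.Ioo (-Real.pi) Real.pi, ‖(P s : ℂ) * (J s : ℂ)‖ ≤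
        J s + ((Set.Ioc (-η) η).indicator (fun s => |F s - P s|) s + 1 / d * |F s - P s|) := by
      intro s hs
      have hJ0 : 0 ≤ J s := jackson_nonneg _ _ _
      have hPF : |P s| ≤ 1 + |F s - P s| := by
        have h := abs_sub_abs_le_abs_sub (P s) (F s)
        have hF' : |F s| = 1 := by rcases hF1 s with h | h <;> simp [h]
        rw [hF', abs_sub_comm] at h
        linarith
      have hJG : J s * |F s - P s| ≤
          (Set.Ioc (-η) η).indicator (fun s => |F s - P s|) s + 1 / d * |F s - P s| := by
        by_cases hsη : s ∈ Set.Ioc (-η) η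
        · rw [Set.indicator_of_mem hsη]
          have := mul_le_of_le_one_left (abs_nonneg (F s - P s)) (jackson_le_one d ⌈Real.log d⌉₊ s)
          have : 0 ≤ 1 / d * |F s - P s| := by positivity
          linarith
        · rw [Set.indicator_of_notMem hsη, zero_add]
          refine mul_le_mul_of_nonneg_right (jackson_ceil_log_le hd
            (abs_le.mpr ⟨hs.1.le, hs.2.le⟩) ?_) (abs_nonneg _)
          rw [Set.mem_Ioc, not_and_or, not_lt, not_le] at hsη
          rcases hsη with h | h
          · exact le_abs.mpr (Or.inr (by linarith))
          · exact le_abs.mpr (Or.inl h.le)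
      rw [norm_mul, Complex.norm_real, Complex.norm_real, Real.norm_eq_abs, Real.norm_eq_abs,
        abs_of_nonneg hJ0]
      nlinarith [mul_le_mul_of_nonneg_right hPF hJ0]
    have hi2 := hind.add ((hG (-Real.pi) Real.pi).const_mul (1 / (d : ℝ)))
    have hi1 := hJc.intervalIntegrable (μ := volume) (-Real.pi) Real.pi
    refine (intervalIntegral.integral_mono_on_of_le_Ioo (by linarith)
      ((by fun_prop : Continuous fun s => ‖(P s : ℂ) * (J s : ℂ)‖).intervalIntegrable _ _)
      (hi1.add hi2) hle).trans ?_
    rw [intervalIntegral.integral_add hi1 hi2, intervalIntegral.integral_add hind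
      ((hG (-Real.pi) Real.pi).const_mul (1 / (d : ℝ))), intervalIntegral.integral_const_mul]
    have : 1 / (d : ℝ) * ∫ s in (-Real.pi)..Real.pi, |F s - P s| ≤ 1 / d :=
      mul_le_of_le_one_right (by positivity) h1
    have h3 : (2 * Real.pi + 2) / (d : ℝ) = 2 * Real.pi / d + (1 / d + 1 / d) := by ring
    linarith
  have hPsmall : ∀ t ∈ Set.Icc (0 : ℝ) (1 / (100 * d)), |P t| ≤ 1 / 2 := by
    intro t ht
    have htd : d * |t| ≤ 1 / 100 := by
      rw [abs_of_nonneg ht.1]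
      have := ht.2
      rw [le_div_iff₀ (by positivity)] at this
      linarith
    have hA := (isTrigPoly_jackson d ⌈Real.log d⌉₊).norm_sub_zero_le hJ2 t
    have hB := (hP.mul (isTrigPoly_jackson d ⌈Real.log d⌉₊)).norm_sub_zero_le hPJ t
    rw [hP0, jackson_zero, Complex.ofReal_one, Complex.ofReal_zero, zero_mul, sub_zero, norm_mul,
      Complex.norm_real, Complex.norm_real, Real.norm_eq_abs, Real.norm_eq_abs,
      abs_of_nonneg (jackson_nonneg _ _ _)] at hB
    rw [jackson_zero, Complex.ofReal_one, ← Complex.ofReal_one, ← Complex.ofReal_sub,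
      Complex.norm_real, Real.norm_eq_abs] at hA
    have hA2 : (2 * ((2 * d : ℕ) : ℝ) + 1) * ((2 * d : ℕ) : ℝ) * (2 * Real.pi / d) /
        (2 * Real.pi) * |t| ≤ 9 / 100 := by
      have : (2 * ((2 * d : ℕ) : ℝ) + 1) * ((2 * d : ℕ) : ℝ) * (2 * Real.pi / d) /
        (2 * Real.pi) * |t| = (8 * d + 2) * |t| := by
        push_cast; field_simp; ring
      rw [this]
      nlinarith [abs_nonneg t]
    have hB2 : (2 * ((d + 2 * d : ℕ) : ℝ) + 1) * ((d + 2 * d : ℕ) : ℝ) *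
        ((2 * Real.pi + 2) / d) / (2 * Real.pi) * |t| ≤ 27 / 100 := by
      have : (2 * ((d + 2 * d : ℕ) : ℝ) + 1) * ((d + 2 * d : ℕ) : ℝ) *
        ((2 * Real.pi + 2) / d) / (2 * Real.pi) * |t| =
          (18 * d + 3) * |t| * (1 + 1 / Real.pi) := by
        push_cast; field_simp; ring
      rw [this]
      have h5 : 1 / Real.pi ≤ 1 / 3 := one_div_le_one_div_of_le (by norm_num) Real.pi_gt_three.le
      have h6 : (18 * d + 3) * |t| ≤ 195 / 1000 := by nlinarith [abs_nonneg t]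
      have h7 : 0 ≤ (18 * d + 3) * |t| := by positivity
      nlinarith
    have hJt : 91 / 100 ≤ J t := by
      have := (abs_le.mp (hA.trans hA2)).1
      linarith
    have := hB.trans hB2
    by_contra hcon
    have := mul_le_mul (not_le.mp hcon).le hJt (by norm_num) (abs_nonneg _)
    linarith
  calc 1 / (200 * (d : ℝ)) = ∫ _ in (0 : ℝ)..1 / (100 * d), (1 / 2 : ℝ) := by
        rw [intervalIntegral.integral_const]; simp; ring
    _ ≤ _ := intervalIntegral.integral_mono_on (by positivity) intervalIntegrable_const (hG _ _)
        fun t ht => half_le_abs_sub (hF1 t) (hPsmall t ht)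

lemma exists_eq_zero_of_boolSign_ne {P : ℝ → ℝ} (hP : Continuous P) {a b : ℝ} (hab : a ≤ b)
    (h : boolSign (P a) ≠ boolSign (P b)) : ∃ r ∈ Set.Icc a b, P r = 0 := by
  unfold boolSign at h
  split_ifs at h with h1 h2 h2
  · exact absurd rfl h
  · exact intermediate_value_Icc' hab hP.continuousOn ⟨(not_le.mp h2).le, h1⟩
  · exact intermediate_value_Icc hab hP.continuousOn ⟨(not_le.mp h1).le, h2⟩
  · exact absurd rfl h

lemma intervalIntegral_lt_of_lintegral_lt {G : ℝ → ℝ} (hG0 : ∀ s, 0 ≤ G s) {a b W t : ℝ}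
    (hab : a ≤ b) (hi : IntervalIntegrable G volume a b) (ha : -W ≤ a) (hb : b ≤ W) (ht : 0 < t)
    (h : ∫⁻ s in Set.Icc (-W) W, ENNReal.ofReal (G s) < ENNReal.ofReal t) :
    ∫ s in a..b, G s < t := by
  rw [← ENNReal.ofReal_lt_ofReal_iff ht, intervalIntegral.integral_of_le hab,
    ofReal_integral_eq_lintegral_ofReal
      ((intervalIntegrable_iff_integrableOn_Ioc_of_le hab).mp hi)
      (Filter.Eventually.of_forall hG0)]
  refine (lintegral_mono_set ?_).trans_lt h
  exact Set.Ioc_subset_Icc_self.trans (Set.Icc_subset_Icc ha hb)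

lemma continuous_eval_ellipsePoint {n : ℕ} (p : MvPolynomial (Fin n) ℝ)
    (w : (Fin n → ℝ) × (Fin n → ℝ)) :
    Continuous fun s => MvPolynomial.eval (ellipsePoint w s) p := by
  have h : Continuous fun s => ellipsePoint w s := by unfold ellipsePoint; fun_prop
  exact (MvPolynomial.continuous_eval p).comp h

lemma eval_ellipsePoint_ne_zero {n d : ℕ} (hd : 2 ≤ d) {f : (Fin n → ℝ) → ℝ} (hf : Measurable f)
    (hf1 : ∀ x, f x = 1 ∨ f x = -1) {p : MvPolynomial (Fin n) ℝ} (hp : p.totalDegree ≤ d)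
    {w : (Fin n → ℝ) × (Fin n → ℝ)} {r : ℝ} (hr0 : 0 ≤ r) (hr : r ≤ 3 * (Real.log d / d))
    (hrpi : r ≤ Real.pi)
    (h1 : ∫⁻ s in Set.Icc (-(2 * Real.pi)) (2 * Real.pi),
      ENNReal.ofReal |f (ellipsePoint w s) - MvPolynomial.eval (ellipsePoint w s) p| <
        ENNReal.ofReal 1)
    (h2 : ∫⁻ s in Set.Icc (-(25 * (Real.log d / d))) (25 * (Real.log d / d)),
      ENNReal.ofReal |f (ellipsePoint w s) - MvPolynomial.eval (ellipsePoint w s) p| <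
        ENNReal.ofReal (1 / (200 * d))) :
    MvPolynomial.eval (ellipsePoint w r) p ≠ 0 := by
  intro hz
  have hL := log_two_le_log_natCast hd
  have hd0 : (0 : ℝ) < d := by positivity
  have hpi := Real.pi_pos
  have hmeas : ∀ v : (Fin n → ℝ) × (Fin n → ℝ), Measurable fun s => f (ellipsePoint v s) :=
    fun v => hf.comp ((continuous_ellipsePoint n).comp
      (by fun_prop : Continuous fun s : ℝ => (v, s))).measurable
  have hint := intervalIntegrable_abs_sub (hmeas w) (fun s => hf1 _)
    (continuous_eval_ellipsePoint p w)
  have hlt {a b W t : ℝ} := intervalIntegral_lt_of_lintegral_lt (a := a) (b := b) (W := W) (t := t)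
    (fun s => abs_nonneg (f (ellipsePoint w s) - MvPolynomial.eval (ellipsePoint w s) p))
  have hshift : ∀ a b, ∫ s in a..b, |f (ellipsePoint (ContinuousLinearMap.rotation r w) s) -
      MvPolynomial.eval (ellipsePoint (ContinuousLinearMap.rotation r w) s) p| =
      ∫ s in (r + a)..(r + b), |f (ellipsePoint w s) -
        MvPolynomial.eval (ellipsePoint w s) p| := by
    intro a b
    simp only [ellipsePoint_rotation]
    exact intervalIntegral.integral_comp_add_left
      (fun s => |f (ellipsePoint w s) - MvPolynomial.eval (ellipsePoint w s) p|) r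
  have hLd : 1 / (100 * (d : ℝ)) ≤ Real.log d / d := by
    rw [div_le_div_iff₀ (by positivity) hd0]; nlinarith
  have h100 : 0 < 1 / (100 * (d : ℝ)) := by positivity
  have h20 : 20 * Real.log d / d = 20 * (Real.log d / d) := by ring
  have key := le_integral_abs_sub_of_eq_zero hd
    (hmeas (ContinuousLinearMap.rotation r w)) (fun s => hf1 _)
    (continuous_eval_ellipsePoint p (ContinuousLinearMap.rotation r w))
    (IsTrigPoly.mvPolynomial_eval_ellipsePoint hp _)
    (by rw [ellipsePoint_rotation, add_zero, hz])
    (by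
      rw [hshift]
      exact (hlt (by linarith) (hint _ _) (by linarith) (by linarith) one_pos h1).le)
    (by
      rw [hshift, h20]
      refine (hlt (by linarith) (hint _ _) (by linarith) (by linarith) (by positivity) h2).le.trans
        ?_
      gcongr; linarith)
  rw [hshift] at key
  exact absurd (hlt (by linarith) (hint _ _) (by linarith) (by linarith) (by positivity) h2)
    (not_lt.mpr key)

lemma arccos_one_sub_le {ρ : ℝ} (h0 : 0 ≤ ρ) (h2 : ρ ≤ 2) :
    Real.arccos (1 - ρ) ≤ 3 * √ρ := by
  set θ := Real.arccos (1 - ρ) with hθ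
  have hθ0 : 0 ≤ θ := Real.arccos_nonneg _
  have hθpi : θ ≤ Real.pi := Real.arccos_le_pi _
  have hc : Real.cos θ = 1 - ρ := Real.cos_arccos (by linarith) (by linarith)
  have h1 := Real.cos_le_one_sub_mul_cos_sq (x := θ) (by rwa [abs_of_nonneg hθ0])
  have h3 : θ ^ 2 * 2 ≤ ρ * Real.pi ^ 2 := by
    rw [← div_le_iff₀ (by positivity)]
    linarith [(by ring : 2 / Real.pi ^ 2 * θ ^ 2 = θ ^ 2 * 2 / Real.pi ^ 2)]
  have h4 : Real.pi ^ 2 ≤ 18 := by nlinarith [Real.pi_lt_d2, Real.pi_pos]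
  rw [← pow_le_pow_iff_left₀ hθ0 (by positivity) two_ne_zero, mul_pow, Real.sq_sqrt h0]
  nlinarith

lemma gns_le_of_log {n d : ℕ} (hd : 2 ≤ d) {f : (Fin n → ℝ) → ℝ} (hf : Measurable f)
    (hf1 : ∀ x, f x = 1 ∨ f x = -1) {p : MvPolynomial (Fin n) ℝ} (hp : p.totalDegree ≤ d) :
    gns n ((Real.log d / d) ^ 2) f ≤
      20000 * Real.log d * ∫ x, |f x - MvPolynomial.eval x p| ∂(gaussian n) := by
  have hL := log_two_le_log_natCast hd
  have hd0 : (0 : ℝ) < d := by positivity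
  have hpi := Real.pi_pos
  have hx0 : 0 ≤ Real.log d / d := by positivity
  have hx1 : Real.log d / d ≤ 1 :=
    (div_le_one hd0).mpr ((Real.log_le_sub_one_of_pos hd0).trans (by linarith))
  have hρ : (Real.log d / d) ^ 2 ≤ 2 := (pow_le_one₀ hx0 hx1).trans (by norm_num)
  rw [gns_eq n (by positivity) hρ]
  set θ := Real.arccos (1 - (Real.log d / d) ^ 2) with hθ
  have hθ0 : 0 ≤ θ := Real.arccos_nonneg _
  have hθpi : θ ≤ Real.pi := Real.arccos_le_pi _
  have hθle : θ ≤ 3 * (Real.log d / d) := by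
    simpa [Real.sqrt_sq hx0] using arccos_one_sub_le (by positivity) hρ
  set E := ∫ x, |f x - MvPolynomial.eval x p| ∂(gaussian n) with hEdef
  have hE : 0 ≤ E := integral_nonneg fun _ => abs_nonneg _
  have hg : Measurable fun x => ENNReal.ofReal |f x - MvPolynomial.eval x p| :=
    (hf.sub (measurable_mvPolynomial_eval p)).abs.ennreal_ofReal
  have m1 := measureReal_window_le hg hE (lintegral_ofReal_abs_sub hf hf1 p)
    (W := 2 * Real.pi) (t := 1) (by positivity) one_pos
  have m2 := measureReal_window_le hg hE (lintegral_ofReal_abs_sub hf hf1 p)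
    (W := 25 * (Real.log d / d)) (t := 1 / (200 * d)) (by positivity) (by positivity)
  have m3 := measureReal_ne_boolSign_le hf hf1 p 0
  have m4 := measureReal_ne_boolSign_le hf hf1 p θ
  set A1 := {w : (Fin n → ℝ) × (Fin n → ℝ) | ENNReal.ofReal 1 ≤ ∫⁻ s in
    Set.Icc (-(2 * Real.pi)) (2 * Real.pi),
      ENNReal.ofReal |f (ellipsePoint w s) - MvPolynomial.eval (ellipsePoint w s) p|} with hA1
  set A2 := {w : (Fin n → ℝ) × (Fin n → ℝ) | ENNReal.ofReal (1 / (200 * d)) ≤ ∫⁻ s in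
    Set.Icc (-(25 * (Real.log d / d))) (25 * (Real.log d / d)),
      ENNReal.ofReal |f (ellipsePoint w s) - MvPolynomial.eval (ellipsePoint w s) p|} with hA2
  set A3 := {w : (Fin n → ℝ) × (Fin n → ℝ) |
    f (ellipsePoint w 0) ≠ boolSign (MvPolynomial.eval (ellipsePoint w 0) p)} with hA3
  set A4 := {w : (Fin n → ℝ) × (Fin n → ℝ) |
    f (ellipsePoint w θ) ≠ boolSign (MvPolynomial.eval (ellipsePoint w θ) p)} with hA4
  have hsub : {w : (Fin n → ℝ) × (Fin n → ℝ) | f (ellipsePoint w 0) ≠ f (ellipsePoint w θ)} ⊆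
      (A1 ∪ A2) ∪ (A3 ∪ A4) := by
    intro w hw
    by_contra hcon
    simp only [Set.mem_union, not_or, hA1, hA2, hA3, hA4, Set.mem_ofPred_eq, not_le, not_not]
      at hcon
    obtain ⟨⟨h1, h2⟩, h3, h4⟩ := hcon
    rw [Set.mem_ofPred_eq, h3, h4] at hw
    obtain ⟨r, hr, hz⟩ := exists_eq_zero_of_boolSign_ne (continuous_eval_ellipsePoint p w) hθ0 hw
    exact eval_ellipsePoint_ne_zero hd hf hf1 hp hr.1 (hr.2.trans hθle) (hr.2.trans hθpi) h1 h2 hz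
  have hm : ((gaussian n).prod (gaussian n)).real {w : (Fin n → ℝ) × (Fin n → ℝ) |
      f (ellipsePoint w 0) ≠ f (ellipsePoint w θ)} ≤ _ :=
    (measureReal_mono hsub).trans ((measureReal_union_le _ _).trans
      (add_le_add ((measureReal_union_le _ _).trans (add_le_add m1 m2))
        ((measureReal_union_le _ _).trans (add_le_add m3 m4))))
  refine hm.trans ?_
  have e2 : 2 * (25 * (Real.log d / d)) * E / (1 / (200 * d)) = 10000 * Real.log d * E := by
    field_simp; ring
  rw [e2, div_one]
  have := mul_le_mul_of_nonneg_right Real.pi_lt_d2.le hE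
  have := mul_le_mul_of_nonneg_right hL hE
  linarith

lemma card_boolSign_ne_le {d : ℕ} {P : ℝ → ℝ} (hPc : Continuous P)
    (hP : IsTrigPoly d fun s => (P s : ℂ)) {θ : ℝ} (hθ : 0 < θ) {M : ℕ} (hM : M * θ ≤ Real.pi) :
    ((Finset.range M).filter fun k : ℕ =>
      boolSign (P (k * θ)) ≠ boolSign (P (k * θ + θ))).card ≤ 4 * d := by
  obtain ⟨q, hq, hPq⟩ := hP
  set S := (Finset.range M).filter fun k : ℕ =>
    boolSign (P (k * θ)) ≠ boolSign (P (k * θ + θ)) with hS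
  rcases eq_or_ne q 0 with rfl | hq0
  · have hP0 : ∀ s, P s = 0 := fun s => by simpa using hPq s
    simp [hS, hP0]
  have hex : ∀ k : ℕ, ∃ r : ℝ, k ∈ S → r ∈ Set.Icc (k * θ) (k * θ + θ) ∧ P r = 0 := by
    intro k
    by_cases hk : k ∈ S
    · obtain ⟨r, hr, h0⟩ := exists_eq_zero_of_boolSign_ne hPc (by linarith)
        (Finset.mem_filter.mp hk).2
      exact ⟨r, fun _ => ⟨hr, h0⟩⟩
    · exact ⟨0, fun h => absurd h hk⟩
  choose r hr using hex
  have hrange : ∀ k ∈ S, r k ∈ Set.Icc 0 Real.pi := by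
    intro k hk
    obtain ⟨⟨h1, h2⟩, -⟩ := hr k hk
    have hkM : (k : ℝ) + 1 ≤ M := by
      exact_mod_cast Finset.mem_range.mp (Finset.mem_filter.mp hk).1
    exact ⟨le_trans (by positivity) h1, h2.trans (le_trans (by nlinarith) hM)⟩
  have himage : S.image (fun k => Complex.exp (r k * Complex.I)) ⊆ q.roots.toFinset := by
    intro z hz
    obtain ⟨k, hk, rfl⟩ := Finset.mem_image.mp hz
    rw [Multiset.mem_toFinset, Polynomial.mem_roots hq0, Polynomial.IsRoot, ← hPq]
    simp [(hr k hk).2]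
  have hroots : (S.image fun k => Complex.exp (r k * Complex.I)).card ≤ 2 * d :=
    (Finset.card_le_card himage).trans ((Multiset.toFinset_card_le _).trans
      ((Polynomial.card_roots' q).trans hq))
  have hfiber : ∀ z ∈ S.image (fun k => Complex.exp (r k * Complex.I)),
      (S.filter fun k => Complex.exp (r k * Complex.I) = z).card ≤ 2 := by
    intro z hz
    obtain ⟨l, hl, rfl⟩ := Finset.mem_image.mp hz
    refine (Finset.card_le_card (t := Finset.Icc (⌊r l / θ⌋₊ - 1) ⌊r l / θ⌋₊) fun k hk => ?_).trans
      (by rw [Nat.card_Icc]; omega)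
    obtain ⟨hk, hkl⟩ := Finset.mem_filter.mp hk
    have hcos := congrArg Complex.re hkl
    rw [Complex.exp_ofReal_mul_I_re, Complex.exp_ofReal_mul_I_re] at hcos
    rw [← Real.injOn_cos (hrange k hk) (hrange l hl) hcos]
    obtain ⟨⟨h1, h2⟩, -⟩ := hr k hk
    rw [Finset.mem_Icc]
    constructor
    · rw [Nat.sub_le_iff_le_add]
      refine Nat.floor_le_of_le ?_
      rw [div_le_iff₀ hθ]; push_cast; linarith
    · exact Nat.le_floor ((le_div_iff₀ hθ).mpr h1)
  have := Finset.card_le_mul_card_image S 2 hfiber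
  omega

lemma mul_measureReal_boolSign_ne_le {n d : ℕ} {p : MvPolynomial (Fin n) ℝ}
    (hp : p.totalDegree ≤ d) {θ : ℝ} (hθ : 0 < θ) {M : ℕ} (hM : M * θ ≤ Real.pi) :
    M * ((gaussian n).prod (gaussian n)).real
      {w | boolSign (MvPolynomial.eval (ellipsePoint w 0) p) ≠
        boolSign (MvPolynomial.eval (ellipsePoint w θ) p)} ≤ 4 * d := by
  set μ := (gaussian n).prod (gaussian n) with hμ
  set B : ℕ → Set ((Fin n → ℝ) × (Fin n → ℝ)) := fun k =>
    {w | boolSign (MvPolynomial.eval (ellipsePoint w (k * θ)) p) ≠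
      boolSign (MvPolynomial.eval (ellipsePoint w (k * θ + θ)) p)} with hB
  have hmeas : ∀ s, Measurable fun w : (Fin n → ℝ) × (Fin n → ℝ) =>
      boolSign (MvPolynomial.eval (ellipsePoint w s) p) := fun s =>
    measurable_boolSign.comp ((measurable_mvPolynomial_eval p).comp
      (measurePreserving_ellipsePoint n s).measurable)
  have hBm : ∀ k, MeasurableSet (B k) := fun k =>
    (measurableSet_eq_fun (hmeas _) (hmeas _)).compl
  have hBk : ∀ k, μ.real (B k) = μ.real (B 0) := by
    intro k
    have h := (measurePreserving_rotation n (k * θ)).measureReal_preimage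
      (hBm 0).nullMeasurableSet
    rw [← hμ] at h
    rw [← h]
    congr 1
    ext w
    simp [hB, ellipsePoint_rotation, -ellipsePoint_zero]
  have hB0 : B 0 = {w | boolSign (MvPolynomial.eval (ellipsePoint w 0) p) ≠
        boolSign (MvPolynomial.eval (ellipsePoint w θ) p)} := by
    simp [hB]
  rw [← hB0]
  calc M * μ.real (B 0) = ∑ k ∈ Finset.range M, μ.real (B k) := by
        simp [hBk]
    _ = ∫ w, ∑ k ∈ Finset.range M, (B k).indicator (fun _ => (1 : ℝ)) w ∂μ := by
        rw [integral_finsetSum _ fun k _ => (integrable_const (1 : ℝ)).indicator (hBm k)]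
        exact Finset.sum_congr rfl fun k _ => (integral_indicator_one (hBm k)).symm
    _ ≤ ∫ _, (4 * d : ℝ) ∂μ := by
        refine integral_mono (integrable_finsetSum _ fun k _ =>
          (integrable_const (1 : ℝ)).indicator (hBm k)) (integrable_const _) fun w => ?_
        have h := card_boolSign_ne_le (continuous_eval_ellipsePoint p w)
          (IsTrigPoly.mvPolynomial_eval_ellipsePoint hp w) hθ hM
        rw [Finset.card_filter] at h
        refine le_trans (le_of_eq ?_) (by exact_mod_cast h : ((_ : ℕ) : ℝ) ≤ 4 * d)
        push_cast
        refine Finset.sum_congr rfl fun k _ => ?_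
        simp [Set.indicator_apply, hB]
    _ = 4 * d := by simp

lemma measureReal_boolSign_ne_le {n d : ℕ} {p : MvPolynomial (Fin n) ℝ}
    (hp : p.totalDegree ≤ d) {θ : ℝ} (hθ : 0 < θ) (hθpi : θ ≤ Real.pi) :
    ((gaussian n).prod (gaussian n)).real
      {w | boolSign (MvPolynomial.eval (ellipsePoint w 0) p) ≠
        boolSign (MvPolynomial.eval (ellipsePoint w θ) p)} ≤ 8 * d * θ / Real.pi := by
  have hpi := Real.pi_pos
  have h := mul_measureReal_boolSign_ne_le hp hθ (M := ⌊Real.pi / θ⌋₊)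
    ((le_div_iff₀ hθ).mp (Nat.floor_le (by positivity)))
  set N := ((gaussian n).prod (gaussian n)).real
      {w | boolSign (MvPolynomial.eval (ellipsePoint w 0) p) ≠
        boolSign (MvPolynomial.eval (ellipsePoint w θ) p)} with hN
  have hN0 : 0 ≤ N := measureReal_nonneg
  have hfl : Real.pi / θ ≤ 2 * ⌊Real.pi / θ⌋₊ := by
    have h1 : (1 : ℝ) ≤ ⌊Real.pi / θ⌋₊ := by
      exact_mod_cast (Nat.one_le_floor_iff _).mpr ((one_le_div hθ).mpr hθpi)
    have h2 := Nat.lt_floor_add_one (Real.pi / θ)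
    linarith
  rw [le_div_iff₀ hpi]
  rw [div_le_iff₀ hθ] at hfl
  have h3 := mul_le_mul_of_nonneg_left hfl hN0
  have h4 := mul_le_mul_of_nonneg_right h (by positivity : 0 ≤ 2 * θ)
  linarith

lemma gns_le_of_mem_Ioo {n d : ℕ} {f : (Fin n → ℝ) → ℝ} (hf : Measurable f)
    (hf1 : ∀ x, f x = 1 ∨ f x = -1) {p : MvPolynomial (Fin n) ℝ} (hp : p.totalDegree ≤ d)
    {ε : ℝ} (hε : ε ∈ Set.Ioo (0 : ℝ) 1) :
    gns n ε f ≤ 2 * ∫ x, |f x - MvPolynomial.eval x p| ∂(gaussian n) + 8 * d * √ε := by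
  rw [gns_eq n hε.1.le (by linarith [hε.2])]
  set θ := Real.arccos (1 - ε) with hθ
  have hθ0 : 0 < θ := Real.arccos_pos.mpr (by linarith [hε.1])
  have hθle : θ ≤ 3 * √ε := arccos_one_sub_le hε.1.le (by linarith [hε.2])
  have hpi := Real.pi_gt_three
  have hmono : ((gaussian n).prod (gaussian n)).real {w : (Fin n → ℝ) × (Fin n → ℝ) |
      f (ellipsePoint w 0) ≠ f (ellipsePoint w θ)} ≤ _ :=
    (measureReal_mono (s₂ := ({w | f (ellipsePoint w 0) ≠
        boolSign (MvPolynomial.eval (ellipsePoint w 0) p)} ∪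
      {w | f (ellipsePoint w θ) ≠ boolSign (MvPolynomial.eval (ellipsePoint w θ) p)}) ∪
      {w | boolSign (MvPolynomial.eval (ellipsePoint w 0) p) ≠
        boolSign (MvPolynomial.eval (ellipsePoint w θ) p)}) (by
      intro w hw
      by_contra hcon
      simp only [Set.mem_union, not_or, Set.mem_ofPred_eq, not_not] at hcon
      obtain ⟨⟨h1, h2⟩, h3⟩ := hcon
      exact hw (h1.trans (h3.trans h2.symm)))).trans ((measureReal_union_le _ _).trans
        (add_le_add ((measureReal_union_le _ _).trans
          (add_le_add (measureReal_ne_boolSign_le hf hf1 p 0)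
            (measureReal_ne_boolSign_le hf hf1 p θ)))
          (measureReal_boolSign_ne_le hp hθ0 (Real.arccos_le_pi _))))
  refine hmono.trans ?_
  have : 8 * d * θ / Real.pi ≤ 8 * d * √ε := by
    rw [div_le_iff₀ (by linarith), mul_assoc _ √ε]
    refine mul_le_mul_of_nonneg_left (hθle.trans ?_) (by positivity)
    nlinarith [Real.sqrt_nonneg ε]
  linarith

/-- Structural result relating `L¹(γ_n)` polynomial approximation of a Boolean function to
its Gaussian noise sensitivity: for every `±1`-valued `f` and degree-`≤ d` polynomial `p`,
(i) `‖f − p‖₁ ≥ (c/log d) · GNS_{(log d/d)²}(f)`; and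
(ii) for all `ε ∈ (0,1)`, `‖f − p‖₁ ≥ GNS_ε(f)/4 − C d √ε`. -/
theorem stmt_10 : ∃ c > (0:ℝ), ∃ C > (0:ℝ), ∀ n : ℕ, 0 < n → ∀ d : ℕ, 2 ≤ d →
    ∀ f : (Fin n → ℝ) → ℝ, Measurable f → (∀ x, f x = 1 ∨ f x = -1) →
    ∀ p : MvPolynomial (Fin n) ℝ, p.totalDegree ≤ d →
      ((c / Real.log d) * gns n ((Real.log d / d) ^ 2) f ≤
          ∫ x, |f x - MvPolynomial.eval x p| ∂(gaussian n)) ∧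
      (∀ ε : ℝ, ε ∈ Set.Ioo (0:ℝ) 1 →
        gns n ε f / 4 - C * d * Real.sqrt ε ≤
          ∫ x, |f x - MvPolynomial.eval x p| ∂(gaussian n)) := by
  refine ⟨1 / 20000, by norm_num, 2, by norm_num, fun n _ d hd f hf hf1 p hp => ⟨?_, fun ε hε => ?_⟩⟩
  · have hL := log_two_le_log_natCast hd
    have h := gns_le_of_log hd hf hf1 hp
    rw [div_mul_eq_mul_div, div_le_iff₀ (by linarith)]
    linarith
  · have h := gns_le_of_mem_Ioo hf hf1 hp hε
    have hE : 0 ≤ ∫ x, |f x - MvPolynomial.eval x p| ∂(gaussian n) :=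
      integral_nonneg fun _ => abs_nonneg _
    linarith
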